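/- For concentric balls conj-closure(B(a,r)) ⊂ B(a,R) in O² ≅ ℝ¹⁶ with 0 < r < R, the function u₀(x) = max{ (1/(r^{-6} - R^{-6})) (-|x-a|^{-6} + R^{-6}), -1 } satisfies: u₀ ≤ 0 on B(a,R), u₀ = -1 on the closed ball of radius r, u₀ = 0 on the sphere of radius R, and u₀ restricted to each octonionic line {a + bt : t ∈ O} (with b ∈ O² a unit vector) is subharmonic in t. -/

import Mathlib

noncomputable section

open Quaternion

/-- The octonions, as the Cayley–Dickson double of the quaternions. -/
@[ext] structure Octonion : Type where
  q1 : Quaternion ℝ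
  q2 : Quaternion ℝ

namespace Octonion

def equivProd : Octonion ≃ Quaternion ℝ × Quaternion ℝ :=
  ⟨fun x => (x.q1, x.q2), fun p => ⟨p.1, p.2⟩, fun _ => rfl, fun _ => rfl⟩

instance : AddCommGroup Octonion := equivProd.addCommGroup
instance : Module ℝ Octonion := equivProd.module ℝ
instance : TopologicalSpace Octonion :=
  TopologicalSpace.induced equivProd inferInstance

instance : One Octonion := ⟨⟨1, 0⟩⟩

/-- Cayley–Dickson multiplication: `(a,b)(c,d) = (ac - d̄b, da + b c̄)`. -/
instance : Mul Octonion :=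
  ⟨fun x y => ⟨x.q1 * y.q1 - star y.q2 * x.q2, y.q2 * x.q1 + x.q2 * star y.q1⟩⟩

/-- Octonionic conjugation. -/
def conj (x : Octonion) : Octonion := ⟨star x.q1, -x.q2⟩

/-- The real part of an octonion. -/
def re (x : Octonion) : ℝ := x.q1.re

/-- The imaginary part of an octonion. -/
def im (x : Octonion) : Octonion := (2⁻¹ : ℝ) • (x - conj x)

/-- The squared norm `|x|²` of an octonion. -/
def normSq (x : Octonion) : ℝ := Quaternion.normSq x.q1 + Quaternion.normSq x.q2

/-- The inverse of an octonion (junk value `0` at `0`). -/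
def inv (x : Octonion) : Octonion := (normSq x)⁻¹ • conj x

end Octonion

namespace Octonion

/-- The octonion with coordinates `v : Fin 8 → ℝ` in the standard basis `e₀,…,e₇`. -/
def octOf (v : Fin 8 → ℝ) : Octonion := ⟨⟨v 0, v 1, v 2, v 3⟩, ⟨v 4, v 5, v 6, v 7⟩⟩

end Octonion

open MeasureTheory

/-- A function is subharmonic on a set if it is upper semicontinuous there and satisfies the
sub-mean-value inequality on every closed ball contained in the set. -/
def SubharmonicOn {E : Type*} [NormedAddCommGroup E] [NormedSpace ℝ E] [MeasurableSpace E]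
    (μ : Measure E) (f : E → ℝ) (s : Set E) : Prop :=
  UpperSemicontinuousOn f s ∧
    ∀ x ∈ s, ∀ r > (0 : ℝ), Metric.closedBall x r ⊆ s →
      f x ≤ ⨍ y in Metric.closedBall x r, f y ∂μ


namespace RelExt

theorem octonion_normSq_mul (x y : Octonion) :
    Octonion.normSq (x * y) = Octonion.normSq x * Octonion.normSq y := by
  change Quaternion.normSq (x.q1 * y.q1 - star y.q2 * x.q2)
    + Quaternion.normSq (y.q2 * x.q1 + x.q2 * star y.q1) =
    (Quaternion.normSq x.q1 + Quaternion.normSq x.q2) *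
    (Quaternion.normSq y.q1 + Quaternion.normSq y.q2)
  simp only [Quaternion.normSq_def', Quaternion.re_sub, Quaternion.imI_sub, Quaternion.imJ_sub,
    Quaternion.imK_sub, Quaternion.re_add, Quaternion.imI_add, Quaternion.imJ_add,
    Quaternion.imK_add, Quaternion.re_mul, Quaternion.imI_mul, Quaternion.imJ_mul,
    Quaternion.imK_mul, Quaternion.re_star, Quaternion.imI_star, Quaternion.imJ_star,
    Quaternion.imK_star]
  ring

theorem octonion_normSq_octOf (v : EuclideanSpace ℝ (Fin 8)) :
    Octonion.normSq (Octonion.octOf (fun i => v i)) = ‖v‖ ^ 2 := by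
  rw [EuclideanSpace.real_norm_sq_eq]
  simp only [Octonion.normSq, Octonion.octOf, Fin.sum_univ_eight]
  refine (congrArg₂ (· + ·) (Quaternion.normSq_def' _) (Quaternion.normSq_def' _)).trans ?_
  change (v 0 ^ 2 + v 1 ^ 2 + v 2 ^ 2 + v 3 ^ 2) + (v 4 ^ 2 + v 5 ^ 2 + v 6 ^ 2 + v 7 ^ 2) = _
  ring

/-- The weight `(1 - |z|²)₊ / 2`. -/
def wt (z : EuclideanSpace ℝ (Fin 8)) : ℝ := max (1 - ‖z‖ ^ 2) 0 / 2

theorem wt_nonneg (z) : 0 ≤ wt z := by unfold wt; positivity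

theorem wt_lip : LipschitzWith 1 wt := by
  apply LipschitzWith.of_le_add_mul
  intro x y
  have h1 : dist x y ≥ |‖x‖ - ‖y‖| := by rw [dist_eq_norm]; exact abs_norm_sub_norm_le x y
  have hx := norm_nonneg x
  have hy := norm_nonneg y
  have hd : 0 ≤ dist x y := dist_nonneg
  have h2 : ‖y‖ ≤ ‖x‖ + dist x y := by linarith [neg_abs_le (‖x‖ - ‖y‖)]
  unfold wt
  simp only [NNReal.coe_one, one_mul]
  rcases le_total (1 - ‖x‖ ^ 2) 0 with h | h
  · rw [max_eq_right h]; have := le_max_right (1 - ‖y‖^2) 0; linarith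
  · rw [max_eq_left h]
    have hx1 : ‖x‖ ≤ 1 := by nlinarith
    rcases le_total ‖y‖ 1 with hy1 | hy1
    · have := le_max_left (1 - ‖y‖^2) 0
      nlinarith
    · have := le_max_right (1 - ‖y‖^2) 0
      nlinarith

theorem wt_supp : HasCompactSupport wt := by
  apply HasCompactSupport.intro (isCompact_closedBall (0 : EuclideanSpace ℝ (Fin 8)) 1)
  intro x hx
  have hx : 1 < ‖x‖ := by simpa using hx
  unfold wt
  rw [max_eq_right (by nlinarith)]; simp

theorem wt_deriv_in (z : EuclideanSpace ℝ (Fin 8)) (hz : ‖z‖ < 1) (i : Fin 8) :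
    lineDeriv ℝ wt z (-EuclideanSpace.single i (1:ℝ)) = z i := by
  have hd : HasFDerivAt (fun z : EuclideanSpace ℝ (Fin 8) => (1 - ‖z‖ ^ 2) / 2)
      ((2⁻¹ : ℝ) • (-(2 • innerSL ℝ z) : EuclideanSpace ℝ (Fin 8) →L[ℝ] ℝ)) z := by
    have := ((hasStrictFDerivAt_norm_sq z).hasFDerivAt.const_sub 1).mul_const (2⁻¹ : ℝ)
    simp only [div_eq_mul_inv]
    exact this
  have he : wt =ᶠ[nhds z] (fun z : EuclideanSpace ℝ (Fin 8) => (1 - ‖z‖ ^ 2) / 2) := by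
    filter_upwards [Metric.isOpen_ball.mem_nhds (show z ∈ Metric.ball 0 1 by simpa using hz)]
      with y hy
    have hy : ‖y‖ < 1 := by simpa using hy
    unfold wt
    rw [max_eq_left (by nlinarith [norm_nonneg y])]
  have h := (hd.congr_of_eventuallyEq he).hasLineDerivAt (-EuclideanSpace.single i (1:ℝ))
  rw [h.lineDeriv]
  simp [EuclideanSpace.inner_single_right]

theorem wt_deriv_out (z : EuclideanSpace ℝ (Fin 8)) (hz : 1 < ‖z‖) (v) :
    lineDeriv ℝ wt z v = 0 := by
  have he : wt =ᶠ[nhds z] (fun z : EuclideanSpace ℝ (Fin 8) => (0:ℝ)) := by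
    filter_upwards [(Metric.isClosed_closedBall (x := 0) (ε := 1)).isOpen_compl.mem_nhds
      (show z ∈ (Metric.closedBall 0 1)ᶜ by simpa using hz)]
      with y hy
    have hy : 1 < ‖y‖ := by simpa using hy
    unfold wt
    rw [max_eq_right (by nlinarith [norm_nonneg y])]; simp
  have h := ((hasFDerivAt_const (𝕜 := ℝ) (0:ℝ) z).congr_of_eventuallyEq he).hasLineDerivAt v
  rw [h.lineDeriv]
  simp

theorem g_hasFDeriv (ε : ℝ) (hε : 0 < ε) (i : Fin 8) (y : EuclideanSpace ℝ (Fin 8)) :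
    HasFDerivAt (fun y : EuclideanSpace ℝ (Fin 8) => y i * ((‖y‖ ^ 2 + ε) ^ 4)⁻¹)
      ((y i * (-8 * ((‖y‖ ^ 2 + ε) ^ 5)⁻¹)) • innerSL ℝ y
        + ((‖y‖ ^ 2 + ε) ^ 4)⁻¹ • (EuclideanSpace.proj i : EuclideanSpace ℝ (Fin 8) →L[ℝ] ℝ)) y := by
  have hq : 0 < ‖y‖ ^ 2 + ε := by positivity
  have h1 : HasFDerivAt (fun y : EuclideanSpace ℝ (Fin 8) => y i)
    (EuclideanSpace.proj i : EuclideanSpace ℝ (Fin 8) →L[ℝ] ℝ) y :=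
    (EuclideanSpace.proj i : EuclideanSpace ℝ (Fin 8) →L[ℝ] ℝ).hasFDerivAt
  have h2 : HasDerivAt (fun s : ℝ => ((s + ε) ^ 4)⁻¹) (-4 * ((‖y‖ ^ 2 + ε) ^ 5)⁻¹) (‖y‖ ^ 2) := by
    have := ((((hasDerivAt_id (‖y‖ ^ 2)).add_const ε).fun_pow 4).fun_inv
      (by simpa using (pow_pos hq 4).ne'))
    refine this.congr_deriv ?_
    simp only [id]
    field_simp
    norm_num
    ring
  have h3 := h2.comp_hasFDerivAt y (hasStrictFDerivAt_norm_sq y).hasFDerivAt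
  have h4 := h1.mul h3
  refine h4.congr_fderiv ?_
  ext v
  simp
  ring

theorem g_lip (ε : ℝ) (hε : 0 < ε) (i : Fin 8) : ∃ C,
    LipschitzWith C (fun y : EuclideanSpace ℝ (Fin 8) => y i * ((‖y‖ ^ 2 + ε) ^ 4)⁻¹) := by
  refine ⟨Real.toNNReal (9 * (ε ^ 4)⁻¹), lipschitzWith_of_nnnorm_fderiv_le (𝕜 := ℝ)
    (fun y => (g_hasFDeriv ε hε i y).differentiableAt) ?_⟩
  intro y
  rw [(g_hasFDeriv ε hε i y).fderiv, ← NNReal.coe_le_coe, coe_nnnorm, Real.coe_toNNReal _ (by positivity)]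
  have hq : 0 < ‖y‖ ^ 2 + ε := by positivity
  refine ContinuousLinearMap.opNorm_le_bound _ (by positivity) fun v => ?_
  have a1 : |y i| ≤ ‖y‖ := by simpa using PiLp.norm_apply_le y i
  have a2 : |v i| ≤ ‖v‖ := by simpa using PiLp.norm_apply_le v i
  have a3 : |inner ℝ y v| ≤ ‖y‖ * ‖v‖ := abs_real_inner_le_norm y v
  have a4 : ((‖y‖ ^ 2 + ε) ^ 4)⁻¹ ≤ (ε ^ 4)⁻¹ := by
    gcongr; nlinarith [sq_nonneg ‖y‖]
  have a5 : ‖y‖ ^ 2 * ((‖y‖ ^ 2 + ε) ^ 5)⁻¹ ≤ ((‖y‖ ^ 2 + ε) ^ 4)⁻¹ := by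
    rw [pow_succ _ 4, mul_inv, ← mul_assoc, mul_comm (‖y‖ ^ 2), mul_assoc]
    apply mul_le_of_le_one_right (by positivity)
    rw [← div_eq_mul_inv, div_le_one hq]; linarith
  change |y i * (-8 * ((‖y‖ ^ 2 + ε) ^ 5)⁻¹) * inner ℝ y v + ((‖y‖ ^ 2 + ε) ^ 4)⁻¹ * v i| ≤ _
  calc _ ≤ |y i * (-8 * ((‖y‖ ^ 2 + ε) ^ 5)⁻¹) * inner ℝ y v| + |((‖y‖ ^ 2 + ε) ^ 4)⁻¹ * v i| :=
        abs_add_le _ _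
    _ = |y i| * (8 * ((‖y‖ ^ 2 + ε) ^ 5)⁻¹) * |inner ℝ y v| + ((‖y‖ ^ 2 + ε) ^ 4)⁻¹ * |v i| := by
        simp only [abs_mul, abs_neg, abs_inv, abs_pow, abs_of_pos hq]
        norm_num
    _ ≤ ‖y‖ * (8 * ((‖y‖ ^ 2 + ε) ^ 5)⁻¹) * (‖y‖ * ‖v‖) + ((‖y‖ ^ 2 + ε) ^ 4)⁻¹ * ‖v‖ := by
        gcongr
    _ = 8 * (‖y‖ ^ 2 * ((‖y‖ ^ 2 + ε) ^ 5)⁻¹) * ‖v‖ + ((‖y‖ ^ 2 + ε) ^ 4)⁻¹ * ‖v‖ := by ring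
    _ ≤ 8 * ((ε ^ 4)⁻¹) * ‖v‖ + (ε ^ 4)⁻¹ * ‖v‖ := by
        gcongr
        exact a5.trans a4
    _ = _ := by ring

/-- Integration by parts against the weight, one coordinate. -/
theorem ibp (ε : ℝ) (hε : 0 < ε) (x : EuclideanSpace ℝ (Fin 8)) (ρ : ℝ) (i : Fin 8) :
    ∫ z in Metric.closedBall (0 : EuclideanSpace ℝ (Fin 8)) 1,
      z i * ((x + ρ • z) i * ((‖x + ρ • z‖ ^ 2 + ε) ^ 4)⁻¹)
    = ∫ z, (ρ * ((x + ρ • z) i * (-8 * ((‖x + ρ • z‖ ^ 2 + ε) ^ 5)⁻¹) * (x + ρ • z) i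
        + ((‖x + ρ • z‖ ^ 2 + ε) ^ 4)⁻¹)) * wt z := by
  obtain ⟨C, hC⟩ := g_lip ε hε i
  have hA : LipschitzWith ‖ρ‖₊ (fun z : EuclideanSpace ℝ (Fin 8) => x + ρ • z) := by
    apply LipschitzWith.of_dist_le_mul
    intro a b
    rw [dist_add_left, dist_smul₀]; simp
  have hG := hC.comp hA
  have key := hG.integral_lineDeriv_mul_eq (μ := volume) wt_lip wt_supp
    (EuclideanSpace.single i (1:ℝ))
  have hR : ∫ z, lineDeriv ℝ wt z (-EuclideanSpace.single i (1:ℝ)) *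
      ((fun y : EuclideanSpace ℝ (Fin 8) => y i * ((‖y‖ ^ 2 + ε) ^ 4)⁻¹) ∘
        (fun z : EuclideanSpace ℝ (Fin 8) => x + ρ • z)) z = 
      ∫ z in Metric.closedBall (0 : EuclideanSpace ℝ (Fin 8)) 1,
      z i * ((x + ρ • z) i * ((‖x + ρ • z‖ ^ 2 + ε) ^ 4)⁻¹) := by
    rw [← integral_indicator Metric.isClosed_closedBall.measurableSet]
    apply integral_congr_ae
    have hs : ∀ᵐ z : EuclideanSpace ℝ (Fin 8), z ∉ Metric.sphere (0 : EuclideanSpace ℝ (Fin 8)) 1 := by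
      apply measure_eq_zero_iff_ae_notMem.1
      exact Measure.addHaar_sphere _ _ _
    filter_upwards [hs] with z hz
    have hz : ‖z‖ ≠ 1 := by simpa using hz
    rcases lt_or_gt_of_ne hz with h | h
    · rw [Set.indicator_of_mem (by simpa using h.le), wt_deriv_in z h i]
      rfl
    · rw [Set.indicator_of_notMem (by simpa using h), wt_deriv_out z h, zero_mul]
  rw [← hR, ← key]
  congr 1
  ext z
  congr 1
  have hAd : HasFDerivAt (fun z : EuclideanSpace ℝ (Fin 8) => x + ρ • z)
      (ρ • ContinuousLinearMap.id ℝ (EuclideanSpace ℝ (Fin 8))) z :=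
    ((hasFDerivAt_id z).const_smul ρ).const_add x
  have := ((g_hasFDeriv ε hε i (x + ρ • z)).comp z hAd).hasLineDerivAt
    (EuclideanSpace.single i (1:ℝ))
  rw [this.lineDeriv]
  simp [EuclideanSpace.inner_single_right]
  ring

theorem div_nonneg (ε : ℝ) (hε : 0 < ε) (x : EuclideanSpace ℝ (Fin 8)) (ρ : ℝ) (hρ : 0 ≤ ρ) :
    0 ≤ ∫ z in Metric.closedBall (0 : EuclideanSpace ℝ (Fin 8)) 1,
      inner ℝ (x + ρ • z) z * ((‖x + ρ • z‖ ^ 2 + ε) ^ 4)⁻¹ := by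
  have hne : ∀ y : EuclideanSpace ℝ (Fin 8), ‖y‖ ^ 2 + ε ≠ 0 := fun y => by positivity
  have e1 : ∀ z : EuclideanSpace ℝ (Fin 8), inner ℝ (x + ρ • z) z * ((‖x + ρ • z‖ ^ 2 + ε) ^ 4)⁻¹
      = ∑ i, z i * ((x + ρ • z) i * ((‖x + ρ • z‖ ^ 2 + ε) ^ 4)⁻¹) := by
    intro z
    simp only [PiLp.inner_apply, Finset.sum_mul]
    refine Finset.sum_congr rfl fun i _ => ?_
    simp
    ring
  simp_rw [e1]
  rw [integral_finsetSum]
  · simp_rw [ibp ε hε x ρ]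
    rw [← integral_finsetSum]
    · apply integral_nonneg
      intro z
      simp only [Pi.zero_apply]
      rw [← Finset.sum_mul]
      refine mul_nonneg ?_ (wt_nonneg z)
      rw [← Finset.mul_sum]
      refine mul_nonneg hρ ?_
      rw [Finset.sum_add_distrib]
      have hq : 0 < ‖x + ρ • z‖ ^ 2 + ε := by positivity
      have hn := EuclideanSpace.real_norm_sq_eq (x + ρ • z)
      have : ∑ i, (x + ρ • z) i * (-8 * ((‖x + ρ • z‖ ^ 2 + ε) ^ 5)⁻¹) * (x + ρ • z) i
        = -8 * ((‖x + ρ • z‖ ^ 2 + ε) ^ 5)⁻¹ * ‖x + ρ • z‖ ^ 2 := by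
        conv_rhs => rw [hn, Finset.mul_sum]
        refine Finset.sum_congr rfl fun i _ => ?_
        rw [← hn]
        ring
      rw [this]
      simp only [Finset.sum_const, Finset.card_univ, Fintype.card_fin, nsmul_eq_mul]
      generalize ‖x + ρ • z‖ ^ 2 = s at hq
      have : -8 * ((s + ε) ^ 5)⁻¹ * s + ((8:ℕ):ℝ) * ((s + ε) ^ 4)⁻¹ = 8 * ε * ((s + ε) ^ 5)⁻¹ := by
        field_simp
        push_cast
        ring
      rw [this]
      positivity
    · intro i _
      apply Continuous.integrable_of_hasCompactSupport
      · have := wt_lip.continuous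
        have h4 : ∀ z : EuclideanSpace ℝ (Fin 8), (‖x + ρ • z‖ ^ 2 + ε) ^ 4 ≠ 0 :=
          fun z => pow_ne_zero _ (hne _)
        have h5 : ∀ z : EuclideanSpace ℝ (Fin 8), (‖x + ρ • z‖ ^ 2 + ε) ^ 5 ≠ 0 :=
          fun z => pow_ne_zero _ (hne _)
        fun_prop (disch := assumption)
      · exact wt_supp.mul_left
  · intro i _
    apply ContinuousOn.integrableOn_compact (isCompact_closedBall _ _)
    apply Continuous.continuousOn
    have h4 : ∀ z : EuclideanSpace ℝ (Fin 8), (‖x + ρ • z‖ ^ 2 + ε) ^ 4 ≠ 0 :=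
      fun z => pow_ne_zero _ (hne _)
    fun_prop (disch := assumption)

theorem mean_deriv (ε : ℝ) (hε : 0 < ε) (x : EuclideanSpace ℝ (Fin 8)) (ρ₀ : ℝ) :
    HasDerivAt (fun ρ : ℝ => ∫ z in Metric.closedBall (0 : EuclideanSpace ℝ (Fin 8)) 1,
      ((‖x + ρ • z‖ ^ 2 + ε) ^ 3)⁻¹)
      (∫ z in Metric.closedBall (0 : EuclideanSpace ℝ (Fin 8)) 1,
        -6 * (inner ℝ (x + ρ₀ • z) z * ((‖x + ρ₀ • z‖ ^ 2 + ε) ^ 4)⁻¹)) ρ₀ := by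
  have hne : ∀ y : EuclideanSpace ℝ (Fin 8), ‖y‖ ^ 2 + ε ≠ 0 := fun y => by positivity
  have hc : ∀ ρ : ℝ, Continuous (fun z : EuclideanSpace ℝ (Fin 8) =>
      ((‖x + ρ • z‖ ^ 2 + ε) ^ 3)⁻¹) := by
    intro ρ
    have h4 : ∀ z : EuclideanSpace ℝ (Fin 8), (‖x + ρ • z‖ ^ 2 + ε) ^ 3 ≠ 0 :=
      fun z => pow_ne_zero _ (hne _)
    fun_prop (disch := assumption)
  have hc' : ∀ ρ : ℝ, Continuous (fun z : EuclideanSpace ℝ (Fin 8) =>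
      -6 * (inner ℝ (x + ρ • z) z * ((‖x + ρ • z‖ ^ 2 + ε) ^ 4)⁻¹)) := by
    intro ρ
    have h4 : ∀ z : EuclideanSpace ℝ (Fin 8), (‖x + ρ • z‖ ^ 2 + ε) ^ 4 ≠ 0 :=
      fun z => pow_ne_zero _ (hne _)
    fun_prop (disch := assumption)
  refine (hasDerivAt_integral_of_dominated_loc_of_deriv_le
    (F := fun ρ (z : EuclideanSpace ℝ (Fin 8)) => ((‖x + ρ • z‖ ^ 2 + ε) ^ 3)⁻¹)
    (F' := fun ρ (z : EuclideanSpace ℝ (Fin 8)) =>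
      -6 * (inner ℝ (x + ρ • z) z * ((‖x + ρ • z‖ ^ 2 + ε) ^ 4)⁻¹))
    (bound := fun _ => 6 * ((‖x‖ + (|ρ₀| + 1)) * (ε ^ 4)⁻¹))
    (Metric.ball_mem_nhds ρ₀ one_pos) ?_ ?_ ?_ ?_ ?_ ?_).2
  · exact Filter.Eventually.of_forall fun ρ => (hc ρ).aestronglyMeasurable
  · exact ((hc ρ₀).continuousOn).integrableOn_compact (isCompact_closedBall _ _)
  · exact (hc' ρ₀).aestronglyMeasurable
  · refine (ae_restrict_iff' Metric.isClosed_closedBall.measurableSet).2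
      (Filter.Eventually.of_forall fun z hz ρ hρ => ?_)
    have hz : ‖z‖ ≤ 1 := by simpa using hz
    have hρ : |ρ| ≤ |ρ₀| + 1 := by
      have : |ρ - ρ₀| < 1 := by simpa [Real.dist_eq] using hρ
      linarith [abs_sub_abs_le_abs_sub ρ ρ₀]
    have a1 : ‖x + ρ • z‖ ≤ ‖x‖ + (|ρ₀| + 1) := by
      refine (norm_add_le _ _).trans ?_
      rw [norm_smul, Real.norm_eq_abs]
      have : |ρ| * ‖z‖ ≤ |ρ| * 1 := by gcongr
      linarith
    have a2 : |inner ℝ (x + ρ • z) z| ≤ ‖x‖ + (|ρ₀| + 1) := by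
      refine (abs_real_inner_le_norm _ _).trans ?_
      calc _ ≤ ‖x + ρ • z‖ * 1 := by gcongr
        _ ≤ _ := by linarith
    have a4 : ((‖x + ρ • z‖ ^ 2 + ε) ^ 4)⁻¹ ≤ (ε ^ 4)⁻¹ := by
      gcongr; nlinarith [sq_nonneg ‖x + ρ • z‖]
    have a5 : 0 ≤ ((‖x + ρ • z‖ ^ 2 + ε) ^ 4)⁻¹ := by positivity
    rw [Real.norm_eq_abs, abs_mul, abs_mul, abs_of_nonneg a5]
    norm_num
    gcongr
  · exact integrableOn_const (by exact (isCompact_closedBall _ _).measure_lt_top.ne)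
  · refine Filter.Eventually.of_forall fun z ρ _ => ?_
    have hq : 0 < ‖x + ρ • z‖ ^ 2 + ε := by positivity
    have h1 : HasDerivAt (fun ρ : ℝ => x + ρ • z) z ρ := by
      simpa using ((hasDerivAt_id ρ).smul_const z).const_add x
    have h2 := ((h1.norm_sq.add_const ε).fun_pow 3).fun_inv (by simpa using (pow_pos hq 3).ne')
    refine h2.congr_deriv ?_
    field_simp
    norm_num
    ring

theorem mean_smooth (ε : ℝ) (hε : 0 < ε) (x : EuclideanSpace ℝ (Fin 8)) (ρ : ℝ) (hρ : 0 ≤ ρ) :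
    ∫ z in Metric.closedBall (0 : EuclideanSpace ℝ (Fin 8)) 1, ((‖x + ρ • z‖ ^ 2 + ε) ^ 3)⁻¹
    ≤ volume.real (Metric.closedBall (0 : EuclideanSpace ℝ (Fin 8)) 1)
      * ((‖x‖ ^ 2 + ε) ^ 3)⁻¹ := by
  have hd := mean_deriv ε hε x
  have hdiff : Differentiable ℝ _ := fun ρ => (hd ρ).differentiableAt
  have hanti := antitoneOn_of_deriv_nonpos (convex_Ici (0:ℝ)) hdiff.continuous.continuousOn
    hdiff.differentiableOn (by
      intro ρ hρ
      have hρ : 0 < ρ := by simpa using hρ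
      rw [(hd ρ).deriv, integral_const_mul]
      have := div_nonneg ε hε x ρ hρ.le
      linarith)
  have := hanti (show (0:ℝ) ∈ Set.Ici 0 by simp) (show ρ ∈ Set.Ici 0 from hρ) hρ
  simpa using this

/-- Truncated Newton kernel. -/
def ker (r : ℝ) (y : EuclideanSpace ℝ (Fin 8)) : ℝ := ((max (‖y‖ ^ 2) (r ^ 2)) ^ 3)⁻¹

theorem ker_cont (r : ℝ) (hr : 0 < r) : Continuous (ker r) := by
  have : ∀ y : EuclideanSpace ℝ (Fin 8), (max (‖y‖ ^ 2) (r ^ 2)) ^ 3 ≠ 0 := fun y => by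
    have : 0 < max (‖y‖ ^ 2) (r ^ 2) := lt_max_of_lt_right (by positivity)
    positivity
  unfold ker
  fun_prop (disch := assumption)

theorem ker_mean (r : ℝ) (hr : 0 < r) (x : EuclideanSpace ℝ (Fin 8)) (ρ : ℝ) (hρ : 0 ≤ ρ) :
    ∫ z in Metric.closedBall (0 : EuclideanSpace ℝ (Fin 8)) 1, ker r (x + ρ • z)
    ≤ volume.real (Metric.closedBall (0 : EuclideanSpace ℝ (Fin 8)) 1) * ker r x := by
  have hfin : volume (Metric.closedBall (0 : EuclideanSpace ℝ (Fin 8)) 1) ≠ ⊤ :=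
    (isCompact_closedBall _ _).measure_lt_top.ne
  have hint : IntegrableOn (fun z => ker r (x + ρ • z))
      (Metric.closedBall (0 : EuclideanSpace ℝ (Fin 8)) 1) := by
    apply ContinuousOn.integrableOn_compact (isCompact_closedBall _ _)
    have := ker_cont r hr
    exact Continuous.continuousOn (by fun_prop)
  rcases le_total (‖x‖ ^ 2) (r ^ 2) with h | h
  · calc _ ≤ ∫ z in Metric.closedBall (0 : EuclideanSpace ℝ (Fin 8)) 1, ker r x := by
          apply setIntegral_mono hint (integrableOn_const hfin)
          intro z
          unfold ker
          rw [max_eq_right h]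
          simp only
          gcongr
          exact le_max_right _ _
      _ = _ := by simp
  · have hx : 0 < ‖x‖ ^ 2 := lt_of_lt_of_le (by positivity) h
    have key : ∀ ε : ℝ, 0 < ε →
        ∫ z in Metric.closedBall (0 : EuclideanSpace ℝ (Fin 8)) 1, ker r (x + ρ • z)
        ≤ (1 + ε / r ^ 2) ^ 3 * (volume.real (Metric.closedBall (0 : EuclideanSpace ℝ (Fin 8)) 1)
          * ker r x) := by
      intro ε hε
      calc _ ≤ ∫ z in Metric.closedBall (0 : EuclideanSpace ℝ (Fin 8)) 1,
            (1 + ε / r ^ 2) ^ 3 * ((‖x + ρ • z‖ ^ 2 + ε) ^ 3)⁻¹ := by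
            apply setIntegral_mono hint
            · apply ContinuousOn.integrableOn_compact (isCompact_closedBall _ _)
              have h4 : ∀ z : EuclideanSpace ℝ (Fin 8), (‖x + ρ • z‖ ^ 2 + ε) ^ 3 ≠ 0 :=
                fun z => by positivity
              exact Continuous.continuousOn (by fun_prop (disch := assumption))
            · intro z
              simp only [ker]
              have hm1 := le_max_left (‖x + ρ • z‖ ^ 2) (r ^ 2)
              have hm2 := le_max_right (‖x + ρ • z‖ ^ 2) (r ^ 2)
              have hq : 0 < ‖x + ρ • z‖ ^ 2 + ε := by positivity
              have hr2 : 0 < r ^ 2 := by positivity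
              generalize max (‖x + ρ • z‖ ^ 2) (r ^ 2) = m at *
              have hm : 0 < m := hr2.trans_le hm2
              rw [← inv_pow, ← inv_pow, ← mul_pow]
              gcongr
              rw [← div_eq_mul_inv, le_div_iff₀ hq, inv_mul_le_iff₀ hm]
              have : ε ≤ m * (ε / r ^ 2) := by
                rw [mul_div_assoc', le_div_iff₀ hr2]
                nlinarith
              linarith
        _ = (1 + ε / r ^ 2) ^ 3 * ∫ z in Metric.closedBall (0 : EuclideanSpace ℝ (Fin 8)) 1,
            ((‖x + ρ • z‖ ^ 2 + ε) ^ 3)⁻¹ := integral_const_mul _ _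
        _ ≤ _ := by
            gcongr
            refine (mean_smooth ε hε x ρ hρ).trans ?_
            unfold ker
            rw [max_eq_left h]
            gcongr
            linarith
    have ht : Filter.Tendsto (fun ε : ℝ => (1 + ε / r ^ 2) ^ 3 *
        (volume.real (Metric.closedBall (0 : EuclideanSpace ℝ (Fin 8)) 1) * ker r x))
        (nhdsWithin 0 (Set.Ioi 0)) (nhds (volume.real
          (Metric.closedBall (0 : EuclideanSpace ℝ (Fin 8)) 1) * ker r x)) := by
      have : Continuous (fun ε : ℝ => (1 + ε / r ^ 2) ^ 3 *
        (volume.real (Metric.closedBall (0 : EuclideanSpace ℝ (Fin 8)) 1) * ker r x)) := by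
        fun_prop
      have := this.tendsto 0
      simp only [zero_div, add_zero, one_pow, one_mul] at this
      exact this.mono_left nhdsWithin_le_nhds
    refine ge_of_tendsto ht ?_
    filter_upwards [self_mem_nhdsWithin] with ε hε
    exact key ε hε

theorem ball_cov (F : EuclideanSpace ℝ (Fin 8) → ℝ) (x : EuclideanSpace ℝ (Fin 8)) (ρ : ℝ)
    (hρ : 0 < ρ) :
    ∫ z in Metric.closedBall (0 : EuclideanSpace ℝ (Fin 8)) 1, F (x + ρ • z)
      = (ρ ^ 8)⁻¹ * ∫ y in Metric.closedBall x ρ, F y := by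
  have h1 := Measure.setIntegral_comp_smul_of_pos volume (fun y => F (x + y))
    (Metric.closedBall (0 : EuclideanSpace ℝ (Fin 8)) 1) hρ
  rw [h1, smul_unitClosedBall_of_nonneg hρ.le]
  have h2 : ∫ y in Metric.closedBall (0 : EuclideanSpace ℝ (Fin 8)) ρ, F (x + y)
      = ∫ y in Metric.closedBall x ρ, F y := by
    have := (measurePreserving_add_left (volume : Measure (EuclideanSpace ℝ (Fin 8))) x
      ).setIntegral_preimage_emb (MeasurableEquiv.addLeft x).measurableEmbedding F
      (Metric.closedBall x ρ)
    rw [← this, preimage_add_closedBall, sub_self]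
  rw [h2]
  simp

theorem ker_average (r : ℝ) (hr : 0 < r) (x : EuclideanSpace ℝ (Fin 8)) (ρ : ℝ) (hρ : 0 < ρ) :
    ⨍ y in Metric.closedBall x ρ, ker r y ≤ ker r x := by
  have h1 := ker_mean r hr x ρ hρ.le
  rw [ball_cov _ _ _ hρ] at h1
  have h2 := ball_cov (fun _ => 1) x ρ hρ
  simp only [integral_const, smul_eq_mul, mul_one, MeasurableSet.univ, measureReal_restrict_apply,
    Set.univ_inter] at h2
  have hV : 0 < volume.real (Metric.closedBall x ρ) :=
    ENNReal.toReal_pos (Metric.measure_closedBall_pos _ _ hρ).ne'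
      (isCompact_closedBall _ _).measure_lt_top.ne
  rw [h2, mul_assoc] at h1
  have h3 := le_of_mul_le_mul_left h1 (by positivity)
  rw [setAverage_eq, smul_eq_mul, inv_mul_le_iff₀ hV]
  exact h3

end RelExt

open Octonion in
/-- The relative extremal function of concentric balls:
`u₀(x) = max{(r⁻⁶ - R⁻⁶)⁻¹(-|x-a|⁻⁶ + R⁻⁶), -1}` satisfies `u₀ ≤ 0` on `B(a,R)`, `u₀ = -1` on
the closed ball of radius `r`, `u₀ = 0` on the sphere of radius `R`, and its restriction to
each octonionic line `{a + bt : t ∈ O}` (with `b₁` real, `|b₁|² + |b₂|² = 1`) is subharmonic. -/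
theorem relative_extremal_concentric_balls (a₁ a₂ : Octonion) (r R : ℝ)
    (hr : 0 < r) (hrR : r < R) :
    letI d : Octonion × Octonion → ℝ := fun p =>
      Octonion.normSq (p.1 - a₁) + Octonion.normSq (p.2 - a₂)
    letI u₀ : Octonion × Octonion → ℝ := fun p =>
      if 0 < d p then
        max (((r ^ 6)⁻¹ - (R ^ 6)⁻¹)⁻¹ * (-((d p) ^ 3)⁻¹ + (R ^ 6)⁻¹)) (-1)
      else -1
    (∀ p, d p < R ^ 2 → u₀ p ≤ 0) ∧
    (∀ p, d p ≤ r ^ 2 → u₀ p = -1) ∧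
    (∀ p, d p = R ^ 2 → u₀ p = 0) ∧
    (∀ b₁ b₂ : Octonion, Octonion.conj b₁ = b₁ →
      Octonion.normSq b₁ + Octonion.normSq b₂ = 1 →
      SubharmonicOn volume
        (fun v : EuclideanSpace ℝ (Fin 8) =>
          u₀ (a₁ + b₁ * octOf (fun i => v i), a₂ + b₂ * octOf (fun i => v i)))
        {v : EuclideanSpace ℝ (Fin 8) |
          d (a₁ + b₁ * octOf (fun i => v i), a₂ + b₂ * octOf (fun i => v i)) < R ^ 2}) := by
  have hR : 0 < R := hr.trans hrR
  have hc : 0 < (r ^ 6)⁻¹ - (R ^ 6)⁻¹ := by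
    rw [sub_pos]
    gcongr
  have hr6 : (r ^ 2) ^ 3 = r ^ 6 := by ring
  have hR6 : (R ^ 2) ^ 3 = R ^ 6 := by ring
  -- closed form of the profile
  have prof : ∀ s : ℝ, (if 0 < s then
        max (((r ^ 6)⁻¹ - (R ^ 6)⁻¹)⁻¹ * (-(s ^ 3)⁻¹ + (R ^ 6)⁻¹)) (-1) else -1)
      = ((r ^ 6)⁻¹ - (R ^ 6)⁻¹)⁻¹ * ((R ^ 6)⁻¹ - ((max s (r ^ 2)) ^ 3)⁻¹) := by
    intro s
    have hm1 : ((r ^ 6)⁻¹ - (R ^ 6)⁻¹)⁻¹ * ((R ^ 6)⁻¹ - (r ^ 6)⁻¹) = -1 := by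
      rw [← neg_sub (r ^ 6)⁻¹, mul_neg, inv_mul_cancel₀ hc.ne']
    rcases le_total s (r ^ 2) with h | h
    · rw [max_eq_right h, hr6, hm1]
      split_ifs with hs
      · apply max_eq_right
        rw [← hm1]
        gcongr
        have : (r ^ 6)⁻¹ ≤ (s ^ 3)⁻¹ := by
          rw [← hr6]; gcongr
        linarith
      · rfl
    · have hs : 0 < s := lt_of_lt_of_le (by positivity) h
      rw [max_eq_left h, if_pos hs, neg_add_eq_sub]
      apply max_eq_left
      rw [← hm1]
      gcongr
      rw [← hr6]; gcongr
  let d : Octonion × Octonion → ℝ := fun p =>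
      Octonion.normSq (p.1 - a₁) + Octonion.normSq (p.2 - a₂)
  let u₀ : Octonion × Octonion → ℝ := fun p =>
      if 0 < d p then
        max (((r ^ 6)⁻¹ - (R ^ 6)⁻¹)⁻¹ * (-((d p) ^ 3)⁻¹ + (R ^ 6)⁻¹)) (-1)
      else -1
  change (∀ p, d p < R ^ 2 → u₀ p ≤ 0) ∧
    (∀ p, d p ≤ r ^ 2 → u₀ p = -1) ∧
    (∀ p, d p = R ^ 2 → u₀ p = 0) ∧
    (∀ b₁ b₂ : Octonion, Octonion.conj b₁ = b₁ →
      Octonion.normSq b₁ + Octonion.normSq b₂ = 1 →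
      SubharmonicOn volume
        (fun v : EuclideanSpace ℝ (Fin 8) =>
          u₀ (a₁ + b₁ * octOf (fun i => v i), a₂ + b₂ * octOf (fun i => v i)))
        {v : EuclideanSpace ℝ (Fin 8) |
          d (a₁ + b₁ * octOf (fun i => v i), a₂ + b₂ * octOf (fun i => v i)) < R ^ 2})
  have hu : ∀ p, u₀ p = ((r ^ 6)⁻¹ - (R ^ 6)⁻¹)⁻¹ * ((R ^ 6)⁻¹ - ((max (d p) (r ^ 2)) ^ 3)⁻¹) :=
    fun p => prof (d p)
  refine ⟨?_, ?_, ?_, ?_⟩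
  · intro p hp
    rw [hu]
    apply mul_nonpos_of_nonneg_of_nonpos (by positivity)
    have hm : max (d p) (r ^ 2) ≤ R ^ 2 := max_le hp.le (by gcongr)
    have hm0 : 0 < max (d p) (r ^ 2) := lt_max_of_lt_right (by positivity)
    rw [sub_nonpos, ← hR6]
    gcongr
  · intro p hp
    rw [hu, max_eq_right hp, hr6, ← neg_sub (r ^ 6)⁻¹, mul_neg, inv_mul_cancel₀ hc.ne']
  · intro p hp
    rw [hu, hp, max_eq_left (by gcongr), hR6]
    simp
  · intro b₁ b₂ _ hb
    have hd : ∀ v : EuclideanSpace ℝ (Fin 8),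
        d (a₁ + b₁ * octOf (fun i => v i), a₂ + b₂ * octOf (fun i => v i)) = ‖v‖ ^ 2 := by
      intro v
      simp only [d, add_sub_cancel_left]
      rw [RelExt.octonion_normSq_mul, RelExt.octonion_normSq_mul, ← add_mul, hb, one_mul,
        RelExt.octonion_normSq_octOf]
    have hf : (fun v : EuclideanSpace ℝ (Fin 8) =>
          u₀ (a₁ + b₁ * octOf (fun i => v i), a₂ + b₂ * octOf (fun i => v i)))
        = fun v => ((r ^ 6)⁻¹ - (R ^ 6)⁻¹)⁻¹ * ((R ^ 6)⁻¹ - RelExt.ker r v) := by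
      funext v
      rw [hu, hd]
      rfl
    rw [hf]
    have hk := RelExt.ker_cont r hr
    refine ⟨?_, ?_⟩
    · exact (Continuous.continuousOn (by fun_prop)).upperSemicontinuousOn
    · intro x _ ρ hρ _
      have hV : 0 < volume.real (Metric.closedBall x ρ) :=
        ENNReal.toReal_pos (Metric.measure_closedBall_pos _ _ hρ).ne'
          (isCompact_closedBall _ _).measure_lt_top.ne
      have hfin : volume (Metric.closedBall x ρ) ≠ ⊤ :=
        (isCompact_closedBall _ _).measure_lt_top.ne
      have h := RelExt.ker_average r hr x ρ hρ
      have hi : IntegrableOn (RelExt.ker r) (Metric.closedBall x ρ) :=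
        hk.continuousOn.integrableOn_compact (isCompact_closedBall _ _)
      have hi' : IntegrableOn (fun _ : EuclideanSpace ℝ (Fin 8) => (R ^ 6)⁻¹)
          (Metric.closedBall x ρ) := integrableOn_const hfin
      have e : ⨍ y in Metric.closedBall x ρ,
          ((r ^ 6)⁻¹ - (R ^ 6)⁻¹)⁻¹ * ((R ^ 6)⁻¹ - RelExt.ker r y)
          = ((r ^ 6)⁻¹ - (R ^ 6)⁻¹)⁻¹ *
            ((R ^ 6)⁻¹ - ⨍ y in Metric.closedBall x ρ, RelExt.ker r y) := by
        rw [setAverage_eq, setAverage_eq, integral_const_mul,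
          integral_sub hi'.integrable hi.integrable, setIntegral_const]
        simp only [smul_eq_mul]
        field_simp
      rw [e]
      exact mul_le_mul_of_nonneg_left (by linarith) (inv_nonneg.2 hc.le)
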